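/- arXiv:2502.11612 — 5 statements merged into one kernel-verified Lean document; each statement's English description precedes it below -/
import Mathlib

section
/- Let π and π' be policies. If (T^{π'} Q^π)(s,a) ≥ Q^π(s,a) for all (s,a) ∈ S × A, then Q^{π'}(s,a) ≥ Q^π(s,a) for all (s,a) ∈ S × A. -/
open scoped BigOperators

/-- The soft Bellman operator `T^π` in a finite MDP. -/
noncomputable def softBellman {S A : Type*} [Fintype S] [Fintype A]
    (p : S × A → PMF S) (r : S × A → ℝ) (γ β : ℝ) (pol : S → PMF A)
    (Q : S × A → ℝ) : S × A → ℝ :=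
  fun sa => r sa + γ * ∑ s' : S, ((p sa) s').toReal *
    ∑ a' : A, ((pol s') a').toReal * (Q (s', a') - β * Real.log (((pol s') a').toReal))


theorem pmf_sum_toReal_eq_one {X : Type*} [Fintype X] (q : PMF X) :
    ∑ x : X, (q x).toReal = 1 := by
  rw [← ENNReal.toReal_sum (fun x _ => q.apply_ne_top x), ← tsum_fintype (L := .unconditional X),
    q.tsum_coe, ENNReal.toReal_one]

/-- If `T^{π'} Q^π ≥ Q^π` pointwise, then `Q^{π'} ≥ Q^π` pointwise. -/
theorem softQ_le_of_bellman_ge {S A : Type*} [Fintype S] [Fintype A]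
    [Nonempty S] [Nonempty A]
    (p : S × A → PMF S) (r : S × A → ℝ) (γ β : ℝ)
    (hγ0 : 0 ≤ γ) (hγ1 : γ < 1) (hβ : 0 < β)
    (pol pol' : S → PMF A)
    (hpol : ∀ s a, 0 < (pol s) a) (hpol' : ∀ s a, 0 < (pol' s) a)
    (Qpol Qpol' : S × A → ℝ)
    (hQpol : softBellman p r γ β pol Qpol = Qpol)
    (hQpol' : softBellman p r γ β pol' Qpol' = Qpol')
    (h : ∀ sa : S × A, Qpol sa ≤ softBellman p r γ β pol' Qpol sa) :
    ∀ sa : S × A, Qpol sa ≤ Qpol' sa := by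
  obtain ⟨m, hm⟩ := Finite.exists_max (fun sa : S × A => Qpol sa - Qpol' sa)
  have hb : softBellman p r γ β pol' Qpol m
      ≤ softBellman p r γ β pol' Qpol' m + γ * (Qpol m - Qpol' m) := by
    unfold softBellman
    rw [add_assoc, ← mul_add]
    gcongr
    have key : ∀ s' : S,
        ∑ a' : A, ((pol' s') a').toReal *
          (Qpol (s', a') - β * Real.log (((pol' s') a').toReal))
        ≤ ∑ a' : A, ((pol' s') a').toReal *
          (Qpol' (s', a') - β * Real.log (((pol' s') a').toReal))
          + (Qpol m - Qpol' m) := by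
      intro s'
      have h1 := pmf_sum_toReal_eq_one (pol' s')
      calc _ ≤ ∑ a' : A, (((pol' s') a').toReal *
            (Qpol' (s', a') - β * Real.log (((pol' s') a').toReal))
            + ((pol' s') a').toReal * (Qpol m - Qpol' m)) := by
              refine Finset.sum_le_sum fun a' _ => ?_
              rw [← mul_add]
              refine mul_le_mul_of_nonneg_left ?_ ENNReal.toReal_nonneg
              have := hm (s', a')
              linarith
        _ = _ := by rw [Finset.sum_add_distrib, ← Finset.sum_mul, h1, one_mul]
    calc _ ≤ ∑ s' : S, (((p m) s').toReal * (∑ a' : A, ((pol' s') a').toReal *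
          (Qpol' (s', a') - β * Real.log (((pol' s') a').toReal)))
          + ((p m) s').toReal * (Qpol m - Qpol' m)) := by
            refine Finset.sum_le_sum fun s' _ => ?_
            rw [← mul_add]
            exact mul_le_mul_of_nonneg_left (key s') ENNReal.toReal_nonneg
      _ = _ := by
            rw [Finset.sum_add_distrib, ← Finset.sum_mul, pmf_sum_toReal_eq_one (p m), one_mul]
  rw [hQpol'] at hb
  have h2 := h m
  have h3 : Qpol m - Qpol' m ≤ 0 := by
    by_contra hc
    push Not at hc
    nlinarith
  intro sa
  have := hm sa
  linarith
end

section
/- (Soft Policy Improvement) Let π and π' be policies. If for every state s ∈ S the inequality Σ_a π'(a|s)·(β·log π'(a|s) − Q^π(s,a)) ≤ Σ_a π(a|s)·(β·log π(a|s) − Q^π(s,a)) holds, then Q^{π'}(s,a) ≥ Q^π(s,a) for all (s,a) ∈ S × A. -/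
open scoped BigOperators

theorem pmf_sum_toReal_aux {α : Type*} [Fintype α] (q : PMF α) :
    ∑ a : α, (q a).toReal = 1 := by
  rw [← ENNReal.toReal_sum (fun a _ => q.apply_ne_top a), ← tsum_fintype (L := .unconditional α),
    q.tsum_coe]
  simp

theorem pmf_avg_le_aux {α : Type*} [Fintype α] (q : PMF α) (f : α → ℝ) (M : ℝ)
    (h : ∀ a, f a ≤ M) : ∑ a : α, (q a).toReal * f a ≤ M := by
  calc ∑ a : α, (q a).toReal * f a ≤ ∑ a : α, (q a).toReal * M :=
        Finset.sum_le_sum fun a _ => mul_le_mul_of_nonneg_left (h a) ENNReal.toReal_nonneg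
    _ = M := by rw [← Finset.sum_mul, pmf_sum_toReal_aux, one_mul]

/-- Soft Policy Improvement: if for every state
`Σ_a π'(a|s)·(β·log π'(a|s) − Q^π(s,a)) ≤ Σ_a π(a|s)·(β·log π(a|s) − Q^π(s,a))`,
then `Q^{π'} ≥ Q^π` pointwise. -/
theorem soft_policy_improvement {S A : Type*} [Fintype S] [Fintype A]
    [Nonempty S] [Nonempty A]
    (p : S × A → PMF S) (r : S × A → ℝ) (γ β : ℝ)
    (hγ0 : 0 ≤ γ) (hγ1 : γ < 1) (hβ : 0 < β)
    (pol pol' : S → PMF A)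
    (hpol : ∀ s a, 0 < (pol s) a) (hpol' : ∀ s a, 0 < (pol' s) a)
    (Qpol Qpol' : S × A → ℝ)
    (hQpol : softBellman p r γ β pol Qpol = Qpol)
    (hQpol' : softBellman p r γ β pol' Qpol' = Qpol')
    (himp : ∀ s : S,
      ∑ a : A, ((pol' s) a).toReal * (β * Real.log (((pol' s) a).toReal) - Qpol (s, a)) ≤
      ∑ a : A, ((pol s) a).toReal * (β * Real.log (((pol s) a).toReal) - Qpol (s, a))) :
    ∀ sa : S × A, Qpol sa ≤ Qpol' sa := by
  obtain ⟨x, hx⟩ := Finite.exists_max (fun sa => Qpol sa - Qpol' sa)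
  have h1 := congrFun hQpol x
  have h2 := congrFun hQpol' x
  simp only [softBellman] at h1 h2
  have key : ∑ s' : S, ((p x) s').toReal *
      ((∑ a' : A, ((pol s') a').toReal *
          (Qpol (s', a') - β * Real.log (((pol s') a').toReal))) -
        ∑ a' : A, ((pol' s') a').toReal *
          (Qpol' (s', a') - β * Real.log (((pol' s') a').toReal))) ≤ Qpol x - Qpol' x := by
    apply pmf_avg_le_aux
    intro s
    have h3 := pmf_avg_le_aux (pol' s) (fun a => Qpol (s, a) - Qpol' (s, a)) _
      (fun a => hx (s, a))
    have h4 := himp s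
    simp only [mul_sub, Finset.sum_sub_distrib] at h3 h4 ⊢
    linarith
  simp only [mul_sub (ENNReal.toReal _) (Finset.sum _ _), Finset.sum_sub_distrib] at key
  have h5 := mul_le_mul_of_nonneg_left key hγ0
  rw [mul_sub] at h5
  have h6 : Qpol x - Qpol' x ≤ 0 := by nlinarith
  intro sa
  have h7 := hx sa
  linarith
end

section
/- (Soft Policy Iteration: monotone convergence of values) Let (π_k)_{k∈ℕ} be a sequence of policies such that for every k and every state s ∈ S, Σ_a π_{k+1}(a|s)·(β·log π_{k+1}(a|s) − Q^{π_k}(s,a)) ≤ Σ_a π_k(a|s)·(β·log π_k(a|s) − Q^{π_k}(s,a)). Then for every (s,a) ∈ S × A, the sequence k ↦ Q^{π_k}(s,a) is monotone nondecreasing and converges to a finite limit. -/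
open scoped BigOperators

theorem pmf_sum_one_aux {X : Type*} [Fintype X] (q : PMF X) : ∑ x, (q x).toReal = 1 := by
  have h := q.tsum_coe
  rw [tsum_fintype] at h
  rw [← ENNReal.toReal_sum (fun a _ => q.apply_ne_top a), h]
  simp

theorem pmf_le_aux {X : Type*} [Fintype X] (q : PMF X) (f : X → ℝ) (M : ℝ)
    (h : ∀ x, f x ≤ M) : ∑ x, (q x).toReal * f x ≤ M := by
  calc ∑ x, (q x).toReal * f x ≤ ∑ x, (q x).toReal * M :=
        Finset.sum_le_sum fun x _ => mul_le_mul_of_nonneg_left (h x) ENNReal.toReal_nonneg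
    _ = M := by rw [← Finset.sum_mul, pmf_sum_one_aux, one_mul]

/-- Soft Policy Iteration: along a sequence of policies each improving on the previous one,
the soft Q-values are monotone nondecreasing and converge to a finite limit. -/
theorem soft_policy_iteration_monotone_convergence {S A : Type*} [Fintype S] [Fintype A]
    [Nonempty S] [Nonempty A]
    (p : S × A → PMF S) (r : S × A → ℝ) (γ β : ℝ)
    (hγ0 : 0 ≤ γ) (hγ1 : γ < 1) (hβ : 0 < β)
    (pol : ℕ → S → PMF A) (hpol : ∀ k s a, 0 < (pol k s) a)
    (Q : ℕ → S × A → ℝ)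
    (hQ : ∀ k, softBellman p r γ β (pol k) (Q k) = Q k)
    (himp : ∀ k, ∀ s : S,
      ∑ a : A, ((pol (k+1) s) a).toReal *
          (β * Real.log (((pol (k+1) s) a).toReal) - Q k (s, a)) ≤
      ∑ a : A, ((pol k s) a).toReal *
          (β * Real.log (((pol k s) a).toReal) - Q k (s, a))) :
    ∀ sa : S × A, Monotone (fun k => Q k sa) ∧
      ∃ L : ℝ, Filter.Tendsto (fun k => Q k sa) Filter.atTop (nhds L) := by
  have hstep : ∀ k sa, Q k sa ≤ Q (k+1) sa := by
    intro k
    obtain ⟨x, hx⟩ := Finite.exists_max (fun sa => Q k sa - Q (k+1) sa)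
    set m := Q k x - Q (k+1) x with hm
    have key : m ≤ γ * m := by
      have h1 := congrFun (hQ k) x
      have h2 := congrFun (hQ (k+1)) x
      simp only [softBellman] at h1 h2
      conv_lhs => rw [hm, ← h1, ← h2, add_sub_add_left_eq_sub, ← mul_sub, ← Finset.sum_sub_distrib]
      apply mul_le_mul_of_nonneg_left _ hγ0
      simp only [← mul_sub]
      apply pmf_le_aux
      intro s
      have h3 : ∑ a : A, ((pol (k+1) s) a).toReal * (Q k (s,a) - Q (k+1) (s,a)) ≤ m :=
        pmf_le_aux _ _ _ (fun a => hx (s,a))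
      have h4 := himp k s
      simp only [mul_sub, Finset.sum_sub_distrib] at h3 h4 ⊢
      linarith
    have hm0 : m ≤ 0 := by nlinarith
    intro sa
    have := hx sa
    linarith
  have hmono : ∀ sa, Monotone (fun k => Q k sa) := fun sa =>
    monotone_nat_of_le_succ fun k => hstep k sa
  obtain ⟨y, hy⟩ := Finite.exists_max r
  have hbdd : ∀ k sa, Q k sa ≤ (r y + γ * (β * Fintype.card A)) / (1 - γ) := by
    intro k
    obtain ⟨x, hx⟩ := Finite.exists_max (Q k)
    have key : Q k x ≤ r y + γ * (Q k x + β * Fintype.card A) := by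
      have h1 := congrFun (hQ k) x
      simp only [softBellman] at h1
      conv_lhs => rw [← h1]
      refine add_le_add (hy x) (mul_le_mul_of_nonneg_left ?_ hγ0)
      apply pmf_le_aux
      intro s
      have h3 : ∑ a : A, ((pol k s) a).toReal * Q k (s,a) ≤ Q k x :=
        pmf_le_aux _ _ _ (fun a => hx (s,a))
      have h5 : ∑ a : A, -(((pol k s) a).toReal * (β * Real.log ((pol k s) a).toReal))
          ≤ ∑ a : A, β := by
        apply Finset.sum_le_sum
        intro a _
        have hp : 0 < ((pol k s) a).toReal :=
          ENNReal.toReal_pos (hpol k s a).ne' ((pol k s).apply_ne_top a)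
        have hl := Real.one_sub_inv_le_log_of_pos hp
        have h6 := mul_le_mul_of_nonneg_left hl hp.le
        rw [mul_sub, mul_inv_cancel₀ hp.ne'] at h6
        nlinarith
      simp only [Finset.sum_neg_distrib, Finset.sum_const, Finset.card_univ, nsmul_eq_mul] at h5
      simp only [mul_sub, Finset.sum_sub_distrib]
      linarith
    intro sa
    refine (hx sa).trans ?_
    rw [le_div_iff₀ (by linarith)]
    linarith
  intro sa
  exact ⟨hmono sa, _, tendsto_atTop_ciSup (hmono sa) ⟨_, by rintro _ ⟨k, rfl⟩; exact hbdd k sa⟩⟩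
end

section
/- (Importance sampling representation of the score, exact expectation form) Let β > 0 and let Q : ℝ^d → ℝ be measurable, bounded above, with exp(Q/β) integrable; set p₀(a) = exp(Q(a)/β)/∫exp(Q/β). Fix s ∈ (0,1) and define p_t(x) = ∫ p₀(a) · φ_{1−s}(x; √s·a) da. Then for every x ∈ ℝ^d, ∇_x log p_t(x) = (1/√(1−s)) · E_{ε ∼ N(0, I_d)}[ w(a₀(ε, x), x) · ε ], where a₀(ε, x) = x/√s + √((1−s)/s)·ε, w(a, x) = exp(Q(a)/β)/Z(x), and Z(x) = ∫ exp(Q(a)/β) · φ_{(1−s)/s}(a; x/√s) da. -/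
open MeasureTheory

/-- The isotropic Gaussian density `φ_v(x; μ) = (2πv)^{−d/2} · exp(−‖x − μ‖²/(2v))`
on `ℝ^d` with mean `μ` and covariance `v·I`. -/
noncomputable def gaussDensity (d : ℕ) (v : ℝ) (x μ : EuclideanSpace ℝ (Fin d)) : ℝ :=
  (2 * Real.pi * v) ^ (-(d : ℝ) / 2) * Real.exp (-‖x - μ‖ ^ 2 / (2 * v))

theorem iss_bound (v t : ℝ) (hv : 0 < v) :
    t * Real.exp (-t ^ 2 / (2 * v)) ≤ v / 2 + 1 := by
  have h1 : t ^ 2 / (2 * v) + 1 ≤ Real.exp (t ^ 2 / (2 * v)) := Real.add_one_le_exp _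
  have h2 : t ≤ t ^ 2 / (2 * v) + v / 2 := by
    have : t ^ 2 / (2 * v) + v / 2 - t = (t - v) ^ 2 / (2 * v) := by
      field_simp
      ring
    have h3 : 0 ≤ (t - v) ^ 2 / (2 * v) := by positivity
    linarith
  have h0 : 0 ≤ t ^ 2 / (2 * v) := by positivity
  have h4 : t ≤ (v / 2 + 1) * Real.exp (t ^ 2 / (2 * v)) := by
    nlinarith
  have h5 : -t ^ 2 / (2 * v) = -(t ^ 2 / (2 * v)) := by ring
  rw [h5, Real.exp_neg, ← div_eq_mul_inv, div_le_iff₀ (Real.exp_pos _)]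
  exact h4

theorem iss_grad {d : ℕ} (f : EuclideanSpace ℝ (Fin d) → ℝ) (hfm : Measurable f)
    (hf : ∀ a, 0 < f a) (hfi : Integrable f) (r v : ℝ) (hv : 0 < v)
    (x : EuclideanSpace ℝ (Fin d)) :
    HasFDerivAt (fun y => ∫ a, f a * Real.exp (-‖y - r • a‖ ^ 2 / (2 * v)))
      (innerSL ℝ (∫ a, (f a * Real.exp (-‖x - r • a‖ ^ 2 / (2 * v)) * v⁻¹) • (r • a - x))) x ∧
    Integrable (fun a => f a * Real.exp (-‖x - r • a‖ ^ 2 / (2 * v))) := by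
  have hmeas : ∀ y : EuclideanSpace ℝ (Fin d),
      Measurable (fun a => f a * Real.exp (-‖y - r • a‖ ^ 2 / (2 * v))) := by
    intro y
    refine hfm.mul (Continuous.measurable ?_)
    fun_prop
  have hint : ∀ y : EuclideanSpace ℝ (Fin d),
      Integrable (fun a => f a * Real.exp (-‖y - r • a‖ ^ 2 / (2 * v))) := by
    intro y
    refine hfi.mono (hmeas y).aestronglyMeasurable (Filter.Eventually.of_forall fun a => ?_)
    rw [norm_mul, Real.norm_of_nonneg (Real.exp_pos _).le]
    refine mul_le_of_le_one_right (norm_nonneg _) (Real.exp_le_one_iff.2 ?_)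
    rw [neg_div]
    have : 0 ≤ ‖y - r • a‖ ^ 2 / (2 * v) := by positivity
    linarith
  refine ⟨?_, hint x⟩
  have hgm : ∀ y : EuclideanSpace ℝ (Fin d), AEStronglyMeasurable
      (fun a => (f a * Real.exp (-‖y - r • a‖ ^ 2 / (2 * v)) * v⁻¹) • (r • a - y)) volume := by
    intro y
    refine AEStronglyMeasurable.smul ((hmeas y).mul_const _).aestronglyMeasurable
      (Continuous.aestronglyMeasurable ?_)
    fun_prop
  have hgb : ∀ y a : EuclideanSpace ℝ (Fin d),
      ‖(f a * Real.exp (-‖y - r • a‖ ^ 2 / (2 * v)) * v⁻¹) • (r • a - y)‖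
        ≤ f a * ((v / 2 + 1) * v⁻¹) := by
    intro y a
    have hp : 0 ≤ f a * Real.exp (-‖y - r • a‖ ^ 2 / (2 * v)) * v⁻¹ := by
      have := hf a
      positivity
    rw [norm_smul, Real.norm_of_nonneg hp, norm_sub_rev (r • a) y]
    have hb := iss_bound v ‖y - r • a‖ hv
    calc _ = f a * ((‖y - r • a‖ * Real.exp (-‖y - r • a‖ ^ 2 / (2 * v))) * v⁻¹) := by ring
      _ ≤ _ := by
        have := (hf a).le
        gcongr
  have hgi : Integrable
      (fun a => (f a * Real.exp (-‖x - r • a‖ ^ 2 / (2 * v)) * v⁻¹) • (r • a - x)) :=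
    (hfi.mul_const ((v / 2 + 1) * v⁻¹)).mono' (hgm x)
      (Filter.Eventually.of_forall fun a => hgb x a)
  rw [← ContinuousLinearMap.integral_comp_comm _ hgi]
  refine hasFDerivAt_integral_of_dominated_of_fderiv_le (𝕜 := ℝ) (s := Set.univ)
    (F := fun y a => f a * Real.exp (-‖y - r • a‖ ^ 2 / (2 * v)))
    (F' := fun y a => innerSL ℝ
      ((f a * Real.exp (-‖y - r • a‖ ^ 2 / (2 * v)) * v⁻¹) • (r • a - y)))
    (bound := fun a => f a * ((v / 2 + 1) * v⁻¹)) Filter.univ_mem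
    (Filter.Eventually.of_forall fun y => (hmeas y).aestronglyMeasurable) (hint x)
    ((innerSL ℝ).continuous.comp_aestronglyMeasurable (hgm x))
    (Filter.Eventually.of_forall fun a y _ => ?_) (hfi.mul_const _)
    (Filter.Eventually.of_forall fun a y _ => ?_)
  · rw [innerSL_apply_norm]
    exact hgb y a
  · have h1 : HasFDerivAt (fun y : EuclideanSpace ℝ (Fin d) => ‖y - r • a‖ ^ 2)
        (2 • (innerSL ℝ (y - r • a)).comp (ContinuousLinearMap.id ℝ _)) y :=
      ((hasFDerivAt_id y).sub_const (r • a)).norm_sq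
    have h2 := (((h1.const_mul (-(2 * v)⁻¹)).exp).const_mul (f a))
    have e1 : (fun y : EuclideanSpace ℝ (Fin d) => f a * Real.exp (-‖y - r • a‖ ^ 2 / (2 * v)))
        = fun y => f a * Real.exp (-(2 * v)⁻¹ * ‖y - r • a‖ ^ 2) := by
      funext y
      congr 2
      ring
    rw [e1]
    refine h2.congr_fderiv ?_
    ext z
    have e2 : -‖y - r • a‖ ^ 2 / (2 * v) = -(2 * v)⁻¹ * ‖y - r • a‖ ^ 2 := by ring
    rw [e2]
    simp only [smul_apply, ContinuousLinearMap.comp_apply, innerSL_apply_apply,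
      ContinuousLinearMap.id_apply, inner_smul_left, smul_eq_mul, nsmul_eq_mul, inner_sub_left,
      RCLike.conj_to_real]
    push_cast
    field_simp
    ring

/-- Importance sampling representation of the score (exact expectation form):
`∇_x log p_t(x) = (1/√(1−s)) · E_{ε∼N(0,I_d)}[w(a₀(ε,x), x) · ε]`, where the expectation over
the standard Gaussian `N(0, I_d)` is written as an integral against its density `φ_1(·; 0)`. -/
theorem importance_sampling_score (d : ℕ) (hd : 1 ≤ d) (β : ℝ) (hβ : 0 < β)
    (Q : EuclideanSpace ℝ (Fin d) → ℝ) (hQm : Measurable Q)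
    (hQb : BddAbove (Set.range Q))
    (hQi : Integrable (fun a => Real.exp (Q a / β)))
    (s : ℝ) (hs : s ∈ Set.Ioo (0 : ℝ) 1)
    (p0 : EuclideanSpace ℝ (Fin d) → ℝ)
    (hp0 : p0 = fun a => Real.exp (Q a / β) / ∫ a', Real.exp (Q a' / β))
    (pt : EuclideanSpace ℝ (Fin d) → ℝ)
    (hpt : pt = fun x => ∫ a, p0 a * gaussDensity d (1 - s) x (Real.sqrt s • a))
    (Z : EuclideanSpace ℝ (Fin d) → ℝ)
    (hZ : Z = fun x =>
      ∫ a, Real.exp (Q a / β) * gaussDensity d ((1 - s) / s) a ((Real.sqrt s)⁻¹ • x))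
    (w : EuclideanSpace ℝ (Fin d) → EuclideanSpace ℝ (Fin d) → ℝ)
    (hw : w = fun a x => Real.exp (Q a / β) / Z x)
    (a0 : EuclideanSpace ℝ (Fin d) → EuclideanSpace ℝ (Fin d) → EuclideanSpace ℝ (Fin d))
    (ha0 : a0 = fun ε x => (Real.sqrt s)⁻¹ • x + Real.sqrt ((1 - s) / s) • ε) :
    ∀ x : EuclideanSpace ℝ (Fin d),
      gradient (fun y => Real.log (pt y)) x
        = (Real.sqrt (1 - s))⁻¹ • ∫ ε, (gaussDensity d 1 ε 0 * w (a0 ε x) x) • ε := by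
  intro x
  obtain ⟨hs0, hs1⟩ := hs
  have hv : 0 < 1 - s := by linarith
  set f : EuclideanSpace ℝ (Fin d) → ℝ := fun a => Real.exp (Q a / β) with hfdef
  have hfm : Measurable f := (hQm.div_const β).exp
  have hf : ∀ a, 0 < f a := fun a => Real.exp_pos _
  set r := Real.sqrt s with hr
  have hr0 : 0 < r := Real.sqrt_pos.2 hs0
  have hrs : r ^ 2 = s := Real.sq_sqrt hs0.le
  set q := Real.sqrt (1 - s) with hq
  have hq0 : 0 < q := Real.sqrt_pos.2 hv
  have hqs : q ^ 2 = 1 - s := Real.sq_sqrt hv.le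
  have hc : Real.sqrt ((1 - s) / s) = q / r := Real.sqrt_div hv.le s
  set c := q / r with hcdef
  have hc0 : 0 < c := div_pos hq0 hr0
  have hcs : (1 - s) / s = c ^ 2 := by rw [hcdef, div_pow, hrs, hqs]
  obtain ⟨hG, hGi⟩ := iss_grad f hfm hf hQi r (1 - s) hv x
  set G : EuclideanSpace ℝ (Fin d) → ℝ :=
    fun y => ∫ a, f a * Real.exp (-‖y - r • a‖ ^ 2 / (2 * (1 - s))) with hGdef
  have hpos : ∀ h : EuclideanSpace ℝ (Fin d) → ℝ, (∀ a, 0 < h a) → Integrable h →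
      0 < ∫ a, h a := by
    intro h h1 h2
    rw [integral_pos_iff_support_of_nonneg (fun a => (h1 a).le) h2]
    have : Function.support h = Set.univ := by
      ext a
      simp [(h1 a).ne']
    rw [this]
    exact Measure.measure_univ_pos.2 (NeZero.ne _)
  have hGpos : 0 < G x := hpos _ (fun a => mul_pos (hf a) (Real.exp_pos _)) hGi
  have hfpos : 0 < ∫ a, f a := hpos f hf hQi
  -- pt is a constant multiple of G
  obtain ⟨K, hK, hptG⟩ : ∃ K : ℝ, K ≠ 0 ∧ pt = fun y => K * G y := by
    refine ⟨(2 * Real.pi * (1 - s)) ^ (-(d : ℝ) / 2) / ∫ a, f a, ?_, ?_⟩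
    · have : 0 < 2 * Real.pi * (1 - s) := by positivity
      exact (div_pos (Real.rpow_pos_of_pos this _) hfpos).ne'
    · rw [hpt]
      funext y
      rw [hGdef]
      simp only
      rw [← integral_const_mul]
      refine integral_congr_ae (Filter.Eventually.of_forall fun a => ?_)
      simp only [hp0, gaussDensity, hfdef]
      ring
  have hgrad : gradient (fun y => Real.log (pt y)) x = (G x)⁻¹ •
      ∫ a, (f a * Real.exp (-‖x - r • a‖ ^ 2 / (2 * (1 - s))) * (1 - s)⁻¹) • (r • a - x) := by
    refine HasGradientAt.gradient ?_
    rw [hasGradientAt_iff_hasFDerivAt, hptG]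
    have h := (hG.const_mul K).log (mul_ne_zero hK hGpos.ne')
    refine h.congr_fderiv ?_
    ext z
    simp only [smul_apply, innerSL_apply_apply, smul_eq_mul,
      InnerProductSpace.toDual_apply_apply, inner_smul_left, RCLike.conj_to_real]
    field_simp
  rw [hgrad]
  have hexp : ∀ a : EuclideanSpace ℝ (Fin d),
      -‖a - r⁻¹ • x‖ ^ 2 / (2 * ((1 - s) / s)) = -‖x - r • a‖ ^ 2 / (2 * (1 - s)) := by
    intro a
    have : x - r • a = (-r) • (a - r⁻¹ • x) := by
      rw [smul_sub, smul_smul, neg_mul, mul_inv_cancel₀ hr0.ne']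
      module
    rw [this, norm_smul, mul_pow, norm_neg, Real.norm_of_nonneg hr0.le, hrs]
    field_simp
  have hZx : Z x = (2 * Real.pi * c ^ 2) ^ (-(d : ℝ) / 2) * G x := by
    rw [hZ, hGdef]
    simp only
    rw [← integral_const_mul]
    refine integral_congr_ae (Filter.Eventually.of_forall fun a => ?_)
    simp only [gaussDensity]
    rw [hexp a, hcs]
    ring
  set H : EuclideanSpace ℝ (Fin d) → EuclideanSpace ℝ (Fin d) := fun a =>
    (f a * Real.exp (-‖x - r • a‖ ^ 2 / (2 * (1 - s))) * (1 - s)⁻¹) • (r • a - x) with hH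
  have hint : ∀ ε : EuclideanSpace ℝ (Fin d), (gaussDensity d 1 ε 0 * w (a0 ε x) x) • ε
      = ((2 * Real.pi) ^ (-(d : ℝ) / 2) * q / Z x) • H (r⁻¹ • x + c • ε) := by
    intro ε
    have e1 : r • (r⁻¹ • x + c • ε) - x = q • ε := by
      rw [smul_add, smul_smul, smul_smul, mul_inv_cancel₀ hr0.ne', hcdef,
        mul_div_cancel₀ _ hr0.ne']
      module
    have e2 : -‖x - r • (r⁻¹ • x + c • ε)‖ ^ 2 / (2 * (1 - s)) = -‖ε‖ ^ 2 / 2 := by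
      rw [norm_sub_rev, e1, norm_smul, mul_pow, Real.norm_of_nonneg hq0.le, hqs]
      field_simp
    rw [hH]
    simp only
    rw [e1, e2, smul_smul, smul_smul, ha0, hw]
    simp only [gaussDensity, hc, sub_zero, mul_one, hfdef]
    congr 1
    rw [← hqs]
    field_simp
    try ring
  have hcv : ∫ ε, H (r⁻¹ • x + c • ε) = (c ^ d)⁻¹ • ∫ a, H a := by
    rw [Measure.integral_comp_smul volume (fun a => H (r⁻¹ • x + a)) c,
      integral_add_left_eq_self H (r⁻¹ • x), finrank_euclideanSpace_fin,
      abs_of_pos (by positivity)]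
  have hpow : (2 * Real.pi * c ^ 2) ^ (-(d : ℝ) / 2)
      = (2 * Real.pi) ^ (-(d : ℝ) / 2) * (c ^ d)⁻¹ := by
    rw [Real.mul_rpow (by positivity) (by positivity)]
    congr 1
    rw [← Real.rpow_natCast c 2, ← Real.rpow_mul hc0.le, ← Real.rpow_natCast c d,
      ← Real.rpow_neg hc0.le]
    congr 1
    push_cast
    ring
  simp_rw [hint]
  rw [integral_smul, hcv, smul_smul, smul_smul, hZx, hpow]
  congr 1
  have hA : (2 * Real.pi) ^ (-(d : ℝ) / 2) ≠ 0 :=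
    (Real.rpow_pos_of_pos (by positivity) _).ne'
  have hcd : c ^ d ≠ 0 := by positivity
  generalize (2 * Real.pi) ^ (-(d : ℝ) / 2) = A at hA ⊢
  generalize c ^ d = B at hcd ⊢
  have := hGpos.ne'
  field_simp
end

section
/- (iDEM gradient representation of the score, exact expectation form) Let β > 0 and let Q : ℝ^d → ℝ be continuously differentiable and bounded above, with exp(Q/β) and ‖∇Q‖·exp(Q/β) integrable; set p₀(a) = exp(Q(a)/β)/∫exp(Q/β). Fix s ∈ (0,1) and define p_t(x) = ∫ p₀(a) · φ_{1−s}(x; √s·a) da. Then for every x ∈ ℝ^d, ∇_x log p_t(x) = (1/√s) · ∫ w(a, x) · (1/β)·∇Q(a) · φ_{(1−s)/s}(a; x/√s) da, where w(a, x) = exp(Q(a)/β)/Z(x) and Z(x) = ∫ exp(Q(a)/β) · φ_{(1−s)/s}(a; x/√s) da. -/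
open MeasureTheory

section helpers
variable {E : Type*} [NormedAddCommGroup E] [InnerProductSpace ℝ E]

/-- Unnormalised Gaussian. -/
noncomputable def gK (v : ℝ) (y : E) : ℝ := Real.exp (-‖y‖ ^ 2 / (2 * v))

/-- Its derivative. -/
noncomputable def gK' (v : ℝ) (y : E) : E →L[ℝ] ℝ := (-(gK v y) / v) • innerSL ℝ y

lemma gK_hasFDerivAt {v : ℝ} (hv : 0 < v) (y : E) : HasFDerivAt (gK v) (gK' v y) y := by
  have h1 : HasFDerivAt (fun y : E => ‖y‖ ^ 2) (2 • (innerSL ℝ y)) y := by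
    have := (hasFDerivAt_id (𝕜 := ℝ) y).norm_sq
    exact this
  have h2 := ((h1.const_mul (-(1 / (2 * v)))).exp)
  have e : (gK v : E → ℝ) = fun y => Real.exp (-(1 / (2 * v)) * ‖y‖ ^ 2) := by
    funext z; unfold gK; congr 1; field_simp
  rw [e]
  refine h2.congr_fderiv ?_
  ext h
  simp only [gK', e, ContinuousLinearMap.smul_apply, smul_eq_mul, nsmul_eq_mul]
  push_cast
  field_simp

lemma gK_cont (v : ℝ) : Continuous (gK v : E → ℝ) := by
  unfold gK; fun_prop

lemma gK'_cont (v : ℝ) : Continuous (gK' v : E → E →L[ℝ] ℝ) := by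
  unfold gK'
  have := gK_cont (E := E) v
  exact (this.neg.div_const v).smul (innerSL ℝ).continuous

lemma gK_pos (v : ℝ) (y : E) : 0 < gK v y := Real.exp_pos _

lemma gK_le {v : ℝ} (hv : 0 < v) (y : E) : ‖gK v y‖ ≤ 1 := by
  rw [Real.norm_of_nonneg (gK_pos v y).le, gK, Real.exp_le_one_iff]
  apply div_nonpos_of_nonpos_of_nonneg
  · have := sq_nonneg ‖y‖; linarith
  · positivity

lemma gK'_le {v : ℝ} (hv : 0 < v) (y : E) : ‖gK' v y‖ ≤ (1 + 2 * v) / v := by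
  have h0 : ‖gK' v y‖ = gK v y * ‖y‖ / v := by
    rw [gK', norm_smul, innerSL_apply_norm, norm_div, norm_neg,
      Real.norm_of_nonneg (gK_pos v y).le, Real.norm_of_nonneg hv.le]
    ring
  rw [h0]
  gcongr
  have h1 : ‖y‖ ^ 2 / (2 * v) + 1 ≤ Real.exp (‖y‖ ^ 2 / (2 * v)) := Real.add_one_le_exp _
  have h2 : gK v y * Real.exp (‖y‖ ^ 2 / (2 * v)) = 1 := by
    rw [gK, ← Real.exp_add]; simp [neg_div]
  have h3 : ‖y‖ ≤ (1 + 2 * v) * (‖y‖ ^ 2 / (2 * v) + 1) := by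
    have : (1 + 2 * v) * (‖y‖ ^ 2 / (2 * v) + 1)
        = ‖y‖ ^ 2 / (2 * v) + ‖y‖ ^ 2 + 1 + 2 * v := by field_simp; ring
    rw [this]
    have : 0 ≤ ‖y‖ ^ 2 / (2 * v) := by positivity
    nlinarith [sq_nonneg (‖y‖ - 1)]
  calc gK v y * ‖y‖ ≤ gK v y * ((1 + 2 * v) * Real.exp (‖y‖ ^ 2 / (2 * v))) := by
        have := (gK_pos v y).le
        gcongr
        exact h3.trans (by gcongr)
    _ = (1 + 2 * v) * (gK v y * Real.exp (‖y‖ ^ 2 / (2 * v))) := by ring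
    _ = 1 + 2 * v := by rw [h2, mul_one]

variable [FiniteDimensional ℝ E] [MeasurableSpace E] [BorelSpace E]

lemma conv_hasGradientAt {v c : ℝ} (hv : 0 < v) (f : E → ℝ) (f' : E → E) (hfc : Continuous f)
    (hf'c : Continuous f')
    (hf : ∀ a, HasGradientAt f (f' a) a) (hfi : Integrable f) (hf'i : Integrable f') (x : E) :
    HasGradientAt (fun x => ∫ a, f a * gK v (a - c • x))
      (c • ∫ a, gK v (a - c • x) • f' a) x := by
  rw [hasGradientAt_iff_hasFDerivAt]
  have hsub : ∀ x : E, Continuous (fun a : E => a - c • x) := fun x => by fun_prop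
  have key : HasFDerivAt (fun x => ∫ a, f a * gK v (a - c • x))
      (∫ a, (f a * (-c)) • gK' v (a - c • x)) x := by
    apply hasFDerivAt_integral_of_dominated_of_fderiv_le (s := Set.univ)
      (F' := fun x a => (f a * (-c)) • gK' v (a - c • x))
      (bound := fun a => ‖f a‖ * (|c| * ((1 + 2 * v) / v))) Filter.univ_mem
    · exact Filter.Eventually.of_forall fun y =>
        (hfc.mul ((gK_cont v).comp (hsub y))).aestronglyMeasurable
    · exact hfi.mul_bdd ((gK_cont v).comp (hsub x)).aestronglyMeasurable
        (Filter.Eventually.of_forall fun a => gK_le hv _)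
    · exact ((hfc.mul continuous_const).smul
        ((gK'_cont v).comp (hsub x))).aestronglyMeasurable
    · refine Filter.Eventually.of_forall fun a y _ => ?_
      rw [norm_smul, norm_mul, norm_neg, mul_assoc, Real.norm_eq_abs c]
      gcongr
      exact gK'_le hv _
    · exact hfi.norm.mul_const _
    · refine Filter.Eventually.of_forall fun a y _ => ?_
      have h1 : HasFDerivAt (fun y : E => a - c • y) (-(c • ContinuousLinearMap.id ℝ E)) y :=
        ((hasFDerivAt_id (𝕜 := ℝ) y).const_smul c).const_sub a
      have h2 := ((gK_hasFDerivAt hv (a - c • y)).comp y h1).const_mul (f a)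
      refine HasFDerivAt.congr_fderiv (f := fun y => f a * gK v (a - c • y)) h2 ?_
      ext h
      simp
      ring
  refine key.congr_fderiv (Eq.symm ?_)
  have hgK' : ∀ h : E, Integrable (fun a => f a * (gK' v (a - c • x)) h) := fun h => by
    refine hfi.mul_bdd (c := (1 + 2 * v) / v * ‖h‖) ?_ ?_
    · exact (((gK'_cont v).comp (hsub x)).clm_apply continuous_const).aestronglyMeasurable
    · refine Filter.Eventually.of_forall fun a => ?_
      exact (ContinuousLinearMap.le_opNorm _ _).trans (by gcongr; exact gK'_le hv _)
  have hint : Integrable (fun a => (f a * (-c)) • gK' v (a - c • x)) := by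
    have := (hfi.mul_const (-c)).smul_bdd ((1 + 2 * v) / v)
      ((gK'_cont v).comp (hsub x)).aestronglyMeasurable
      (Filter.Eventually.of_forall fun a => gK'_le hv _)
    exact this
  have hgf' : Integrable (fun a => gK v (a - c • x) • f' a) :=
    hf'i.bdd_smul 1 ((gK_cont v).comp (hsub x)).aestronglyMeasurable
        (Filter.Eventually.of_forall fun a => gK_le hv _)
  have hdg : ∀ a, HasFDerivAt (fun a => gK v (a - c • x)) (gK' v (a - c • x)) a := fun a => by
    have h1 : HasFDerivAt (fun a : E => a - c • x) (ContinuousLinearMap.id ℝ E) a :=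
      (hasFDerivAt_id (𝕜 := ℝ) a).sub_const _
    exact (gK_hasFDerivAt hv (a - c • x)).comp a h1
  have e1 : ∀ a h, fderiv ℝ f a h = inner ℝ h (f' a) := fun a h => by
    rw [((hasGradientAt_iff_hasFDerivAt).1 (hf a)).fderiv, InnerProductSpace.toDual_apply_apply,
      real_inner_comm]
  have e2 : ∀ a, fderiv ℝ (fun a => gK v (a - c • x)) a = gK' v (a - c • x) :=
    fun a => (hdg a).fderiv
  ext h
  rw [ContinuousLinearMap.integral_apply hint, InnerProductSpace.toDual_apply_apply,
    real_inner_comm, inner_smul_right, ← integral_inner hgf']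
  have ibp := integral_mul_fderiv_eq_neg_fderiv_mul_of_integrable (μ := volume)
    (f := f) (g := fun a => gK v (a - c • x)) (v := h) ?_ ?_ ?_
    (fun a _ => ((hasGradientAt_iff_hasFDerivAt).1 (hf a)).differentiableAt)
    (fun a _ => (hdg a).differentiableAt)
  · simp only [e1, e2] at ibp
    have l : ∀ a, inner ℝ h (gK v (a - c • x) • f' a)
        = inner ℝ h (f' a) * gK v (a - c • x) := fun a => by
      rw [inner_smul_right, mul_comm]
    have r : ∀ a, ((f a * (-c)) • gK' v (a - c • x)) h
        = (-c) * (f a * gK' v (a - c • x) h) := fun a => by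
      simp; ring
    simp only [l, r]
    rw [integral_const_mul, ibp]
    ring
  · simp only [e1]
    have := hgf'.const_inner (𝕜 := ℝ) h
    refine this.congr (Filter.Eventually.of_forall fun a => ?_)
    simp only [inner_smul_right, mul_comm]
  · simp only [e2]; exact hgK' h
  · exact hfi.mul_bdd ((gK_cont v).comp (hsub x)).aestronglyMeasurable
        (Filter.Eventually.of_forall fun a => gK_le hv _)

end helpers

/-- iDEM gradient representation of the score (exact expectation form):
`∇_x log p_t(x) = (1/√s) · ∫ w(a,x) · (1/β)·∇Q(a) · φ_{(1−s)/s}(a; x/√s) da`. -/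
theorem iDEM_score_representation (d : ℕ) (hd : 1 ≤ d) (β : ℝ) (hβ : 0 < β)
    (Q : EuclideanSpace ℝ (Fin d) → ℝ) (hQc : ContDiff ℝ 1 Q)
    (hQb : BddAbove (Set.range Q))
    (hQi : Integrable (fun a => Real.exp (Q a / β)))
    (hQgi : Integrable (fun a => ‖gradient Q a‖ * Real.exp (Q a / β)))
    (s : ℝ) (hs : s ∈ Set.Ioo (0 : ℝ) 1)
    (p0 : EuclideanSpace ℝ (Fin d) → ℝ)
    (hp0 : p0 = fun a => Real.exp (Q a / β) / ∫ a', Real.exp (Q a' / β))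
    (pt : EuclideanSpace ℝ (Fin d) → ℝ)
    (hpt : pt = fun x => ∫ a, p0 a * gaussDensity d (1 - s) x (Real.sqrt s • a))
    (Z : EuclideanSpace ℝ (Fin d) → ℝ)
    (hZ : Z = fun x =>
      ∫ a, Real.exp (Q a / β) * gaussDensity d ((1 - s) / s) a ((Real.sqrt s)⁻¹ • x))
    (w : EuclideanSpace ℝ (Fin d) → EuclideanSpace ℝ (Fin d) → ℝ)
    (hw : w = fun a x => Real.exp (Q a / β) / Z x) :
    ∀ x : EuclideanSpace ℝ (Fin d),
      gradient (fun y => Real.log (pt y)) x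
        = (Real.sqrt s)⁻¹ •
            ∫ a, (w a x * β⁻¹ * gaussDensity d ((1 - s) / s) a ((Real.sqrt s)⁻¹ • x)) •
              gradient Q a := by
  intro x
  obtain ⟨hs0, hs1⟩ := hs
  have hr : 0 < Real.sqrt s := Real.sqrt_pos.2 hs0
  have hr2 : Real.sqrt s ^ 2 = s := Real.sq_sqrt hs0.le
  have hv : 0 < (1 - s) / s := div_pos (by linarith) hs0
  set v := (1 - s) / s with hvdef
  set c := (Real.sqrt s)⁻¹ with hc
  set f : EuclideanSpace ℝ (Fin d) → ℝ := fun a => Real.exp (Q a / β) with hfdef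
  set f' : EuclideanSpace ℝ (Fin d) → EuclideanSpace ℝ (Fin d) :=
    fun a => (f a * β⁻¹) • gradient Q a with hf'def
  have hQd : Differentiable ℝ Q := hQc.differentiable (by norm_num)
  have hgc : Continuous (gradient Q) := by
    unfold gradient
    exact (InnerProductSpace.toDual ℝ _).symm.continuous.comp (hQc.continuous_fderiv (by norm_num))
  have hfc : Continuous f := by
    have := hQc.continuous
    fun_prop
  have hf'c : Continuous f' := (hfc.mul continuous_const).smul hgc
  have hf : ∀ a, HasGradientAt f (f' a) a := fun a => by
    rw [hasGradientAt_iff_hasFDerivAt]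
    have h1 := (hasGradientAt_iff_hasFDerivAt).1 (hQd a).hasGradientAt
    have h2 := (h1.mul_const β⁻¹).exp
    refine HasFDerivAt.congr_fderiv (f := f) h2 (Eq.symm ?_)
    simp [hf'def, hfdef, div_eq_mul_inv, smul_smul]
  have hf'i : Integrable f' := by
    refine (hQgi.const_mul β⁻¹).mono' hf'c.aestronglyMeasurable
      (Filter.Eventually.of_forall fun a => le_of_eq ?_)
    rw [hf'def, norm_smul, Real.norm_of_nonneg (mul_nonneg (Real.exp_pos _).le (inv_pos.2 hβ).le)]
    ring
  have hG := conv_hasGradientAt (c := c) hv f f' hfc hf'c hf hQi hf'i x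
  set H : EuclideanSpace ℝ (Fin d) → ℝ := fun x => ∫ a, f a * gK v (a - c • x) with hH
  have hfpos : 0 < ∫ a, f a := integral_exp_pos hQi
  have hHpos : ∀ y, 0 < H y := fun y => by
    have hi : Integrable (fun a => f a * gK v (a - c • y)) :=
      hQi.mul_bdd ((gK_cont v).comp (by fun_prop)).aestronglyMeasurable
        (Filter.Eventually.of_forall fun a => gK_le hv _)
    have e : ∀ a, f a * gK v (a - c • y)
        = Real.exp (Q a / β + -‖a - c • y‖ ^ 2 / (2 * v)) := fun a => by
      rw [Real.exp_add]; rfl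
    simp only [hH, e] at hi ⊢
    exact integral_exp_pos hi
  set K : ℝ := (2 * Real.pi * v) ^ (-(d : ℝ) / 2) with hK
  have hKpos : 0 < K := by have := Real.pi_pos; positivity
  have hZx : Z x = K * H x := by
    simp only [hZ, hH, ← integral_const_mul]
    congr 1; funext a
    simp only [gaussDensity, gK]
    ring
  obtain ⟨C, hC, hptC⟩ : ∃ C : ℝ, 0 < C ∧ ∀ y, pt y = C * H y := by
    refine ⟨(2 * Real.pi * (1 - s)) ^ (-(d : ℝ) / 2) / ∫ a, f a, ?_, fun y => ?_⟩
    · have := Real.pi_pos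
      have : 0 < 1 - s := by linarith
      positivity
    · simp only [hpt, hp0, hH, ← integral_const_mul]
      congr 1; funext a
      have hn : -‖y - Real.sqrt s • a‖ ^ 2 / (2 * (1 - s)) = -‖a - c • y‖ ^ 2 / (2 * v) := by
        have : y - Real.sqrt s • a = (-Real.sqrt s) • (a - c • y) := by
          rw [smul_sub, smul_smul, hc, neg_mul, mul_inv_cancel₀ hr.ne']
          simp; abel
        have h1s : 1 - s ≠ 0 := by linarith
        rw [this, norm_smul, mul_pow, norm_neg, Real.norm_of_nonneg hr.le, hr2, hvdef]
        field_simp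
      simp only [gaussDensity, gK, hn]
      ring
  have hL : HasGradientAt (fun y => Real.log (pt y))
      ((H x)⁻¹ • (c • ∫ a, gK v (a - c • x) • f' a)) x := by
    have e : (fun y => Real.log (pt y)) = fun y => Real.log C + Real.log (H y) := by
      funext y; rw [hptC, Real.log_mul hC.ne' (hHpos y).ne']
    rw [e, hasGradientAt_iff_hasFDerivAt]
    have h1 := (((hasGradientAt_iff_hasFDerivAt).1 hG).log (hHpos x).ne').const_add (Real.log C)
    refine h1.congr_fderiv (Eq.symm ?_)
    simp
  rw [hL.gradient, smul_comm, ← integral_smul]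
  congr 1
  congr 1
  funext a
  rw [hf'def, smul_smul, smul_smul]
  congr 1
  simp only [hw, hZx]
  have := (hHpos x).ne'
  have := hKpos.ne'
  simp only [gaussDensity, gK, ← hK]
  field_simp
  rfl
end
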